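/- Let μ_X, μ_Y ∈ ℝ and σ_X², σ_Y² ≥ 0. Then the Gaussian measure N(μ_X, σ_X²) second-order stochastically dominates the Gaussian measure N(μ_Y, σ_Y²) if and only if μ_X ≥ μ_Y and σ_X² ≤ σ_Y². -/

import Mathlib

open MeasureTheory ProbabilityTheory
open scoped NNReal ENNReal

/-- `P` second-order stochastically dominates `Q`: for every `u`, the integral of the
difference of the CDFs over `(-∞, u]` is nonpositive. -/
def SSD (P Q : Measure ℝ) : Prop :=
  ∀ u : ℝ, (∫ z in Set.Iic u, (cdf P z - cdf Q z)) ≤ 0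

lemma lint_cdf (P : Measure ℝ) [IsProbabilityMeasure P] (u : ℝ) :
    ∫⁻ z in Set.Iic u, ENNReal.ofReal (cdf P z) = ∫⁻ x, ENNReal.ofReal (u - x) ∂P := by
  have hm : MeasurableSet {p : ℝ × ℝ | p.2 ≤ p.1} := measurableSet_le measurable_snd measurable_fst
  have h1 : ∀ z : ℝ, ENNReal.ofReal (cdf P z)
      = ∫⁻ x, ({p : ℝ × ℝ | p.2 ≤ p.1}.indicator 1 (z, x) : ℝ≥0∞) ∂P := by
    intro z
    rw [ofReal_cdf, ← lintegral_indicator_one measurableSet_Iic]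
    rfl
  simp_rw [h1]
  rw [lintegral_lintegral_swap]
  · refine lintegral_congr fun x => ?_
    have h2 : ∀ z : ℝ, ({p : ℝ × ℝ | p.2 ≤ p.1}.indicator 1 (z, x) : ℝ≥0∞)
        = (Set.Ici x).indicator 1 z := fun z => rfl
    simp_rw [h2]
    rw [lintegral_indicator_one measurableSet_Ici, Measure.restrict_apply measurableSet_Ici,
      Set.Ici_inter_Iic, Real.volume_Icc]
  · exact (Measurable.indicator measurable_one hm).aemeasurable

lemma lint_ne_top (m : ℝ) (v : ℝ≥0) (u : ℝ) :
    ∫⁻ x, ENNReal.ofReal (u - x) ∂(gaussianReal m v) ≠ ∞ := by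
  have hi : Integrable (fun x : ℝ => x) (gaussianReal m v) :=
    (memLp_id_gaussianReal 1).integrable (by simp)
  exact ((integrable_const u).sub hi).lintegral_lt_top.ne

lemma integrable_cdf_gauss (m : ℝ) (v : ℝ≥0) (u : ℝ) :
    Integrable (fun z => cdf (gaussianReal m v) z) (volume.restrict (Set.Iic u)) := by
  refine ⟨(monotone_cdf _).measurable.aestronglyMeasurable, ?_⟩
  rw [hasFiniteIntegral_iff_ofReal (Filter.Eventually.of_forall fun z => cdf_nonneg _ z), lint_cdf]
  exact (lint_ne_top m v u).lt_top

lemma ssd_iff (m n : ℝ) (v w : ℝ≥0) :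
    SSD (gaussianReal m v) (gaussianReal n w) ↔ ∀ u : ℝ,
      ∫⁻ x, ENNReal.ofReal (u - x) ∂(gaussianReal m v)
        ≤ ∫⁻ x, ENNReal.ofReal (u - x) ∂(gaussianReal n w) := by
  unfold SSD
  refine forall_congr' fun u => ?_
  rw [integral_sub (integrable_cdf_gauss m v u) (integrable_cdf_gauss n w u), sub_nonpos,
    integral_eq_lintegral_of_nonneg_ae (Filter.Eventually.of_forall fun z => cdf_nonneg _ z)
      (integrable_cdf_gauss m v u).1,
    integral_eq_lintegral_of_nonneg_ae (Filter.Eventually.of_forall fun z => cdf_nonneg _ z)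
      (integrable_cdf_gauss n w u).1, lint_cdf, lint_cdf,
    ENNReal.toReal_le_toReal (lint_ne_top m v u) (lint_ne_top n w u)]

lemma ofReal_int_le {P : Measure ℝ} {f : ℝ → ℝ} (hf : Integrable f P) :
    ENNReal.ofReal (∫ x, f x ∂P) ≤ ∫⁻ x, ENNReal.ofReal (f x) ∂P := by
  refine ENNReal.ofReal_le_of_le_toReal ?_
  rw [integral_eq_lintegral_pos_part_sub_lintegral_neg_part hf]
  linarith [ENNReal.toReal_nonneg (a := ∫⁻ x, ENNReal.ofReal (-f x) ∂P)]

lemma exp_repr (P : Measure ℝ) [SFinite P] (t : ℝ) :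
    ∫⁻ u, ENNReal.ofReal (Real.exp (-t * u)) * ∫⁻ x, ENNReal.ofReal (u - x) ∂P
      = (∫⁻ s : ℝ, ENNReal.ofReal (Real.exp (-t * s)) * ENNReal.ofReal s) *
        ∫⁻ x, ENNReal.ofReal (Real.exp (-t * x)) ∂P := by
  have h1 : ∀ u : ℝ, ENNReal.ofReal (Real.exp (-t * u)) * ∫⁻ x, ENNReal.ofReal (u - x) ∂P
      = ∫⁻ x, ENNReal.ofReal (Real.exp (-t * u)) * ENNReal.ofReal (u - x) ∂P := fun u =>
    (lintegral_const_mul _ (by fun_prop)).symm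
  simp_rw [h1]
  rw [lintegral_lintegral_swap (by fun_prop), ← lintegral_const_mul _ (by fun_prop)]
  refine lintegral_congr fun x => ?_
  rw [← lintegral_add_right_eq_self _ x, ← lintegral_mul_const _ (by fun_prop)]
  refine lintegral_congr fun s => ?_
  rw [add_sub_cancel_right, mul_add, Real.exp_add, ENNReal.ofReal_mul (Real.exp_nonneg _)]
  ring

lemma const_ne_zero (t : ℝ) :
    (∫⁻ s : ℝ, ENNReal.ofReal (Real.exp (-t * s)) * ENNReal.ofReal s) ≠ 0 := by
  intro h
  rw [lintegral_eq_zero_iff (by fun_prop)] at h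
  have h2 : volume (Set.Ioi (0 : ℝ)) = 0 := by
    refine measure_mono_null ?_ h
    intro s hs
    have hs' : 0 < s := hs
    simp [Real.exp_pos, hs']
  simp at h2

lemma const_ne_top (t : ℝ) (ht : 0 < t) :
    (∫⁻ s : ℝ, ENNReal.ofReal (Real.exp (-t * s)) * ENNReal.ofReal s) ≠ ∞ := by
  have h := (integrableOn_rpow_mul_exp_neg_mul_rpow (p := 1) (s := 1) (b := t)
    (by norm_num) one_pos ht).lintegral_lt_top
  rw [← lintegral_indicator measurableSet_Ioi] at h
  refine ((lintegral_mono fun s => ?_).trans_lt h).ne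
  by_cases hs : 0 < s
  · rw [Set.indicator_of_mem (show s ∈ Set.Ioi (0:ℝ) from hs), Real.rpow_one,
      ENNReal.ofReal_mul hs.le, mul_comm]
  · rw [ENNReal.ofReal_of_nonpos (not_lt.1 hs)]; simp

lemma lint_exp (m : ℝ) (v : ℝ≥0) (t : ℝ) :
    ∫⁻ x, ENNReal.ofReal (Real.exp (-t * x)) ∂(gaussianReal m v)
      = ENNReal.ofReal (Real.exp (-m * t + v * t ^ 2 / 2)) := by
  rw [← ofReal_integral_eq_lintegral_ofReal (integrable_exp_mul_gaussianReal (-t))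
    (Filter.Eventually.of_forall fun x => Real.exp_nonneg _)]
  have h := congrFun (mgf_fun_id_gaussianReal (μ := m) (v := v)) (-t)
  simp only [mgf] at h
  rw [h]
  ring_nf

/-- SSD between Gaussian measures is characterized by ordered means and
reverse-ordered variances. -/
theorem ssd_gaussian_iff (μX μY : ℝ) (σX2 σY2 : ℝ≥0) :
    SSD (gaussianReal μX σX2) (gaussianReal μY σY2) ↔ μY ≤ μX ∧ σX2 ≤ σY2 := by
  rw [ssd_iff]
  constructor
  · intro h
    have key : ∀ t : ℝ, 0 < t → -μX + σX2 * t / 2 ≤ -μY + σY2 * t / 2 := by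
      intro t ht
      have h1 := lintegral_mono (μ := (volume : Measure ℝ)) fun u =>
        mul_le_mul_right (h u) (ENNReal.ofReal (Real.exp (-t * u)))
      rw [exp_repr, exp_repr, ENNReal.mul_le_mul_iff_right (const_ne_zero t) (const_ne_top t ht),
        lint_exp, lint_exp, ENNReal.ofReal_le_ofReal_iff (Real.exp_nonneg _),
        Real.exp_le_exp] at h1
      refine le_of_mul_le_mul_right ?_ ht
      nlinarith
    constructor
    · by_contra! hc
      have hv := σX2.coe_nonneg
      have hw := σY2.coe_nonneg
      have hk := key ((μY - μX) / (σY2 + 1)) (by apply div_pos <;> linarith)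
      have h3 : (σY2 : ℝ) * ((μY - μX) / (σY2 + 1)) ≤ μY - μX := by
        rw [← mul_div_assoc, div_le_iff₀ (by linarith)]
        nlinarith
      have h4 : 0 ≤ (σX2 : ℝ) * ((μY - μX) / (σY2 + 1)) :=
        mul_nonneg hv (div_nonneg (by linarith) (by linarith))
      linarith
    · by_contra! hc
      have hc' : (σY2 : ℝ) < σX2 := by exact_mod_cast hc
      have hd : 0 < (σX2 : ℝ) - σY2 := by linarith
      have hk := key (2 * (|μX - μY| + 1) / (σX2 - σY2)) (by positivity)
      have h3 : ((σX2 : ℝ) - σY2) * (2 * (|μX - μY| + 1) / (σX2 - σY2))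
        = 2 * (|μX - μY| + 1) := by field_simp
      linarith [le_abs_self (μX - μY)]
  · rintro ⟨hm, hv⟩ u
    have hc : gaussianReal μY σY2
        = (gaussianReal μX σX2) ∗ (gaussianReal (μY - μX) (σY2 - σX2)) := by
      rw [gaussianReal_conv_gaussianReal, add_sub_cancel, add_tsub_cancel_of_le hv]
    rw [hc, Measure.lintegral_conv (by fun_prop)]
    refine lintegral_mono fun x => ?_
    have hi : Integrable (fun x : ℝ => x) (gaussianReal (μY - μX) (σY2 - σX2)) :=
      (memLp_id_gaussianReal 1).integrable (by simp)
    have hi2 : Integrable (fun y : ℝ => x + y) (gaussianReal (μY - μX) (σY2 - σX2)) :=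
      (integrable_const x).add hi
    refine le_trans ?_ (ofReal_int_le (f := fun y => u - (x + y))
      ((integrable_const u).sub ((integrable_const x).add hi)))
    apply ENNReal.ofReal_le_ofReal
    rw [integral_sub (integrable_const u) hi2,
      integral_add (integrable_const x) hi, integral_id_gaussianReal]
    simp
    linarith
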